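/- Let S be a finite multiset of segments. (1) S decomposes uniquely as a sum S = S_1 + ⋯ + S_m of connected components: each S_t is connected, any two segments belonging to different S_t have empty intersection, and each S_t is maximal among connected sub-multisets of S. (2) If moreover S is non-negative, then S is of chain shape if and only if every connected component S_t is of chain shape. (Lemma 8.11 of the paper, in the language of supports of local Arthur parameters.) -/

import Mathlib

/-!
Common combinatorial setting for extended multi-segments (Moeglin-Atobe theory),
following Hazeltine-Liu-Lo, "On the intersection of local Arthur packets".
Rows of symbols are 0-indexed; row labels of labeled symbols are natural numbers.
-/

namespace LocalArthur

/-- A row `([A,B], l, eta)` of a symbol (an extended segment with the bound on `l` dropped). -/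
structure Row where
  A : ℚ
  B : ℚ
  l : ℚ
  eta : ℤ
deriving DecidableEq

/-- `a = A + B + 1`. -/
def Row.a (r : Row) : ℚ := r.A + r.B + 1

/-- `b = A - B + 1`. -/
def Row.b (r : Row) : ℚ := r.A - r.B + 1

/-- A rational number is an integer. -/
def IsInt (x : ℚ) : Prop := x.den = 1

instance (x : ℚ) : Decidable (IsInt x) := by unfold IsInt; infer_instance

/-- `(-1)^x` for an integer-valued rational `x` (junk value on non-integers). -/
def m1pow (x : ℚ) : ℤ := if x.num % 2 = 0 then 1 else -1

/-- Validity of a single row: `2A, 2B ∈ ℤ`, `A - B ∈ ℕ`, `l ∈ ℤ`, `eta = ±1`. -/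
def Row.IsES (r : Row) : Prop :=
  IsInt (2 * r.A) ∧ IsInt (2 * r.B) ∧ (∃ n : ℕ, r.A - r.B = (n : ℚ)) ∧
    IsInt r.l ∧ (r.eta = 1 ∨ r.eta = -1)

/-- The segment `[A,B]` of `r` is contained in that of `s`. -/
def Row.subseg (r s : Row) : Prop := s.B ≤ r.B ∧ r.A ≤ s.A

instance (r s : Row) : Decidable (r.subseg s) := by unfold Row.subseg; infer_instance

/-- A symbol: valid rows, `A_i + B_i ≥ 0`, all `A_i` congruent mod `ℤ`, and the
listed order admissible, i.e. condition (P). -/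
def IsSymbol (E : List Row) : Prop :=
  (∀ r ∈ E, r.IsES) ∧ (∀ r ∈ E, 0 ≤ r.A + r.B) ∧
    (∀ r ∈ E, ∀ s ∈ E, IsInt (r.A - s.A)) ∧
    E.Pairwise (fun r s => ¬ (s.A < r.A ∧ s.B < r.B))

/-- An extended multi-segment datum: a symbol with `0 ≤ l_i ≤ b_i / 2`. -/
def IsEMS (E : List Row) : Prop :=
  IsSymbol E ∧ ∀ r ∈ E, 0 ≤ r.l ∧ r.l ≤ r.b / 2

/-- The listed order satisfies (P'). -/
def Pprime (E : List Row) : Prop := E.Pairwise (fun r s => r.B ≤ s.B)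

/-- Equivalence of extended segments. -/
def Row.Equiv (r s : Row) : Prop :=
  r.A = s.A ∧ r.B = s.B ∧ r.l = s.l ∧ (r.eta = s.eta ∨ r.l = r.b / 2)

/-- Rowwise equivalence of symbols. -/
def SymEquiv (E F : List Row) : Prop := List.Forall₂ Row.Equiv E F

/-- Shift of one row: `[A,B] ↦ [A+d, B+d]`. -/
def Row.sh (r : Row) (d : ℤ) : Row := { r with A := r.A + d, B := r.B + d }

/-- Add on one row: `([A,B],l) ↦ ([A+d, B-d], l+d)`. -/
def Row.addOp (r : Row) (d : ℤ) : Row :=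
  { r with A := r.A + d, B := r.B - d, l := r.l + d }

/-- `sh^d` applied to every row. -/
def shAll (d : ℤ) (E : List Row) : List Row := E.map fun r => r.sh d

/-- The updated pair of rows in a row exchange of rows `r = row k` and `s = row k+1`
(assuming one of the segments contains the other); the first component is the new row
at position `k` (the updated `s`) and the second the new row at position `k+1`
(the updated `r`). -/
def rexPair (r s : Row) : Row × Row :=
  if r.subseg s then
    -- Case `[A_k,B_k] ⊆ [A_{k+1},B_{k+1}]`
    (if m1pow (r.A - r.B) * r.eta * s.eta = 1 then
        if s.b - 2 * s.l < 2 * (r.b - 2 * r.l) then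
          (⟨s.A, s.B, s.b - (s.l + (r.b - 2 * r.l)), m1pow (r.A - r.B) * s.eta⟩ : Row)
        else ⟨s.A, s.B, s.l + (r.b - 2 * r.l), m1pow (r.A - r.B + 1) * s.eta⟩
      else ⟨s.A, s.B, s.l - (r.b - 2 * r.l), m1pow (r.A - r.B + 1) * s.eta⟩,
     ⟨r.A, r.B, r.l, m1pow (s.A - s.B) * r.eta⟩)
  else
    -- Case `[A_{k+1},B_{k+1}] ⊊ [A_k,B_k]`
    (⟨s.A, s.B, s.l, m1pow (r.A - r.B) * s.eta⟩,
     if m1pow (r.A - r.B) * r.eta * s.eta = 1 then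
        if r.b - 2 * r.l < 2 * (s.b - 2 * s.l) then
          (⟨r.A, r.B, r.b - (r.l + (s.b - 2 * s.l)), m1pow (s.A - s.B) * r.eta⟩ : Row)
        else ⟨r.A, r.B, r.l + (s.b - 2 * s.l), m1pow (s.A - s.B + 1) * r.eta⟩
      else ⟨r.A, r.B, r.l - (s.b - 2 * s.l), m1pow (s.A - s.B + 1) * r.eta⟩)

/-- Row exchange `R_k` at positions `k, k+1` (0-indexed). -/
def rex (k : ℕ) (E : List Row) : List Row :=
  match E[k]?, E[k+1]? with
  | some r, some s =>
      if r.subseg s ∨ s.subseg r then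
        E.take k ++ (rexPair r s).1 :: (rexPair r s).2 :: E.drop (k + 2)
      else E
  | _, _ => E

/-- One row exchange step. -/
def ReorderStep (E F : List Row) : Prop := ∃ k, F = rex k E

/-- Admissible reorderings: finite sequences of row exchanges. -/
def Reorder : List Row → List Row → Prop := Relation.ReflTransGen ReorderStep

/-- Coincidence up to row exchanges (in either direction) and rowwise equivalence. -/
def UpToRex (E F : List Row) : Prop :=
  ∃ G, Relation.ReflTransGen (fun X Y => ReorderStep X Y ∨ ReorderStep Y X) E G ∧
    SymEquiv G F

/-- `α_i = ∑_{j<i} (A_j + B_j + 1)`. -/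
def alphaAt (E : List Row) (i : ℕ) : ℚ := ((E.take i).map Row.a).sum

/-- `β_i = ∑_{j>i} (A_j - B_j + 1)`. -/
def betaAt (E : List Row) (i : ℕ) : ℚ := ((E.drop (i + 1)).map Row.b).sum

/-- `γ_i = ∑_{j>i} (A_j + B_j + 1)`. -/
def gammaAt (E : List Row) (i : ℕ) : ℚ := ((E.drop (i + 1)).map Row.a).sum

/-- Condition (∗) of the non-vanishing criterion. -/
def StarCond (E : List Row) : Prop :=
  ∀ i : ℕ, ∀ r : Row, E[i]? = some r →
    (IsInt r.B → 0 ≤ r.B + r.l) ∧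
    (¬ IsInt r.B → r.eta = - m1pow (alphaAt E i) → (1 / 2 : ℚ) ≤ r.B + r.l) ∧
    (¬ IsInt r.B → r.eta = m1pow (alphaAt E i) → -(1 / 2 : ℚ) ≤ r.B + r.l)

/-- Xu's non-vanishing conditions at an adjacent pair of rows `(r, s) = (row k, row k+1)`. -/
def XuPair (r s : Row) : Prop :=
  ((r.A ≤ s.A ∧ r.B ≤ s.B) →
    (m1pow (r.A - r.B) * r.eta * s.eta = 1 →
        r.B + r.l ≤ s.B + s.l ∧ r.A - r.l ≤ s.A - s.l) ∧
    (m1pow (r.A - r.B) * r.eta * s.eta = -1 → r.A - r.l < s.B + s.l)) ∧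
  ((r.subseg s ∧ ¬ s.subseg r) →
    (m1pow (r.A - r.B) * r.eta * s.eta = 1 → 0 ≤ s.l - r.l ∧ s.l - r.l ≤ s.b - r.b) ∧
    (m1pow (r.A - r.B) * r.eta * s.eta = -1 → r.b ≤ r.l + s.l)) ∧
  ((s.subseg r ∧ ¬ r.subseg s) →
    (m1pow (r.A - r.B) * r.eta * s.eta = 1 → 0 ≤ r.l - s.l ∧ r.l - s.l ≤ r.b - s.b) ∧
    (m1pow (r.A - r.B) * r.eta * s.eta = -1 → s.b ≤ r.l + s.l))

/-- Xu's non-vanishing conditions at every adjacent pair of rows. -/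
def XuAll (E : List Row) : Prop := E.Chain' XuPair

/-- The non-vanishing criterion for an extended multi-segment datum. -/
def NonVanishing (E : List Row) : Prop :=
  StarCond E ∧
    ∀ d : ℕ, (∀ r ∈ E, 0 ≤ r.B + (d : ℚ)) →
      ∀ F, Reorder (shAll d E) F → XuAll F

/-- Applicability of a union-intersection at an adjacent pair of rows. -/
def uiApplicablePair (r s : Row) : Prop :=
  r.A < s.A ∧ r.B < s.B ∧
    ((m1pow (r.A - r.B) * r.eta * s.eta = 1 ∧
        (s.A - s.l = r.A - r.l ∨ s.B + s.l = r.B + r.l)) ∨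
      (m1pow (r.A - r.B) * r.eta * s.eta = -1 ∧ s.B + s.l = r.A - r.l + 1))

instance (r s : Row) : Decidable (uiApplicablePair r s) := by
  unfold uiApplicablePair; infer_instance

/-- Type 3' of a union-intersection at an adjacent pair. -/
def uiT3 (r s : Row) : Prop :=
  r.l = 0 ∧ s.l = 0 ∧ m1pow (r.A - r.B) * r.eta * s.eta = -1

instance (r s : Row) : Decidable (uiT3 r s) := by unfold uiT3; infer_instance

/-- The pair of rows produced by a union-intersection at an adjacent applicable pair. -/
def uiPair (r s : Row) : Row × Row :=
  if m1pow (r.A - r.B) * r.eta * s.eta = 1 then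
    if s.A - s.l = r.A - r.l then
      -- Case 1
      ((⟨s.A, r.B, r.l, r.eta⟩ : Row),
       (⟨r.A, s.B, s.l - (s.A - r.A), m1pow (s.A - r.A) * s.eta⟩ : Row))
    else
      -- Case 2
      if s.A - r.A ≤ r.b - 2 * r.l then
        (⟨s.A, r.B, r.l + (s.A - r.A), r.eta⟩,
         ⟨r.A, s.B, s.l, m1pow (s.A - r.A) * s.eta⟩)
      else
        (⟨s.A, r.B, r.b - r.l, - r.eta⟩,
         ⟨r.A, s.B, s.l, m1pow (s.A - r.A) * s.eta⟩)
  else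
    -- Case 3
    if s.l ≤ r.l then
      (⟨s.A, r.B, r.l, r.eta⟩, ⟨r.A, s.B, s.l, m1pow (s.A - r.A) * s.eta⟩)
    else
      (⟨s.A, r.B, r.l, r.eta⟩, ⟨r.A, s.B, r.l, m1pow (s.A - r.A + 1) * s.eta⟩)

/-- Union-intersection at positions `k, k+1` (deleting the second new row in type 3'). -/
def uiAt (k : ℕ) (E : List Row) : List Row :=
  match E[k]?, E[k+1]? with
  | some r, some s =>
      if uiApplicablePair r s then
        if uiT3 r s then
          E.take k ++ (uiPair r s).1 :: E.drop (k + 2)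
        else
          E.take k ++ (uiPair r s).1 :: (uiPair r s).2 :: E.drop (k + 2)
      else E
  | _, _ => E

/-- Minimality: no union-intersection is applicable. -/
def MinimalP (E : List Row) : Prop :=
  ∀ F, Reorder E F → ∀ k r s, F[k]? = some r → F[k+1]? = some s →
    ¬ uiApplicablePair r s

/-- The image of a row under Atobe's dual. -/
def dualRow (E : List Row) (i : ℕ) (r : Row) : Row :=
  let α := alphaAt E i
  let β := betaAt E i
  let η₀ : ℤ := if ¬ IsInt r.B ∧ r.l = r.b / 2 then - m1pow α else r.eta
  if IsInt r.B then
    ⟨r.A, -r.B, r.l + r.B, m1pow (α + β) * η₀⟩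
  else
    ⟨r.A, -r.B, r.l + r.B + ((m1pow α * η₀ : ℤ) : ℚ) / 2, - (m1pow (α + β) * η₀)⟩

/-- Atobe's dual of a symbol whose order satisfies (P'). -/
def dual (E : List Row) : List Row :=
  (E.mapIdx fun i r => dualRow E i r).reverse

/-- Applicability of the partial dual `dual_k^+` at position `k` (0-indexed). -/
def DualPlusApplicable (E : List Row) (k : ℕ) : Prop :=
  ∃ r, E[k]? = some r ∧ r.B = 1 / 2 ∧ r.l = 0 ∧ r.eta = - m1pow (alphaAt E k) ∧
    ∀ i, i < k → ∀ s, E[i]? = some s → s.B < 1 / 2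

/-- The partial dual `dual_k^+` at position `k`. -/
def dualPlus (k : ℕ) (E : List Row) : List Row :=
  match E[k]? with
  | some rk =>
      (dual ((dual E).set (E.length - 1 - k)
          ⟨rk.A, 1 / 2, 0, - m1pow (gammaAt E k)⟩)).take k ++
        (⟨rk.A, -(1 / 2), 0, - rk.eta⟩ : Row) :: E.drop (k + 1)
  | none => E

/-- Applicability of the partial dual `dual_k^-`. -/
def DualMinusApplicable (E : List Row) (k : ℕ) : Prop :=
  DualPlusApplicable (dual E) (E.length - 1 - k)

/-- The partial dual `dual_k^-`. -/
def dualMinus (k : ℕ) (E : List Row) : List Row :=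
  dual (dualPlus (E.length - 1 - k) (dual E))

/-- Maximality: `E` is not, up to row exchanges, the result of a union-intersection
applied to a non-vanishing extended multi-segment datum. -/
def Maximal (E : List Row) : Prop :=
  ¬ ∃ (E'' F : List Row) (k : ℕ) (r s : Row), IsEMS E'' ∧ NonVanishing E'' ∧
      Reorder E'' F ∧ F[k]? = some r ∧ F[k+1]? = some s ∧ uiApplicablePair r s ∧
      UpToRex (uiAt k F) E

/-- Absolute maximality. -/
def AbsolutelyMaximal (E : List Row) : Prop := Maximal E ∧ MinimalP (dual E)

/-- The sign `(-1)^{⌊b/2⌋ + l} * eta^b` of a row. -/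
def rowSign (r : Row) : ℤ :=
  (if (⌊r.b / 2⌋ + ⌊r.l⌋) % 2 = 0 then (1 : ℤ) else -1) * r.eta ^ (⌊r.b⌋.toNat)

/-- The sign product of a symbol. -/
def signProd (E : List Row) : ℤ := (E.map rowSign).prod

/-! ### Labeled symbols: rows carry labels that travel with them under reorderings. -/

/-- A labeled row. -/
abbrev LRow := ℕ × Row

/-- The underlying list of rows of a labeled symbol. -/
def rows (L : List LRow) : List Row := L.map Prod.snd

/-- `sh_i^d`, acting on the row labeled `i`. -/
def shL (i : ℕ) (d : ℤ) (L : List LRow) : List LRow :=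
  L.map fun p => if p.1 = i then (p.1, p.2.sh d) else p

/-- `add_i^d`, acting on the row labeled `i`. -/
def addL (i : ℕ) (d : ℤ) (L : List LRow) : List LRow :=
  L.map fun p => if p.1 = i then (p.1, p.2.addOp d) else p

/-- `sh^d` on a labeled symbol. -/
def shAllL (d : ℤ) (L : List LRow) : List LRow := L.map fun p => (p.1, p.2.sh d)

/-- Row exchange at positions `k, k+1` on a labeled symbol. -/
def rexL (k : ℕ) (L : List LRow) : List LRow :=
  match L[k]?, L[k+1]? with
  | some (a, r), some (c, s) =>
      if r.subseg s ∨ s.subseg r then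
        L.take k ++ (c, (rexPair r s).1) :: (a, (rexPair r s).2) :: L.drop (k + 2)
      else L
  | _, _ => L

/-- One row exchange step on labeled symbols. -/
def ReorderStepL (L M : List LRow) : Prop := ∃ k, M = rexL k L

/-- Admissible reorderings of labeled symbols. -/
def ReorderL : List LRow → List LRow → Prop := Relation.ReflTransGen ReorderStepL

/-- Labelwise equivalence of labeled symbols. -/
def LSymEquiv (L M : List LRow) : Prop :=
  List.Forall₂ (fun p q => p.1 = q.1 ∧ Row.Equiv p.2 q.2) L M

/-- `M` coincides with `L` up to row exchanges and rowwise equivalence (labels forgotten). -/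
def CoincidesUpToRex (L M : List LRow) : Prop :=
  ∃ L', Relation.ReflTransGen (fun X Y => ReorderStepL X Y ∨ ReorderStepL Y X) L L' ∧
    SymEquiv (rows L') (rows M)

/-- Union-intersection at positions `k, k+1` on a labeled symbol. -/
def uiAtL (k : ℕ) (L : List LRow) : List LRow :=
  match L[k]?, L[k+1]? with
  | some (a, r), some (c, s) =>
      if uiApplicablePair r s then
        if uiT3 r s then
          L.take k ++ (a, (uiPair r s).1) :: L.drop (k + 2)
        else
          L.take k ++ (a, (uiPair r s).1) :: (c, (uiPair r s).2) :: L.drop (k + 2)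
      else L
  | _, _ => L

/-- The relation `M = ui_{i,j}(L)`, with a constraint `P` on the adjacent pair used:
some admissible reordering `L'` of `L` puts the row labeled `i` immediately before the
row labeled `j`, `ui` is applicable there, and `M` is obtained from the result by row
exchanges restoring the original relative order of the (surviving) labels. -/
def UIrelWith (P : Row → Row → Prop) (L : List LRow) (i j : ℕ) (M : List LRow) : Prop :=
  ∃ (L' : List LRow) (k : ℕ) (r s : Row),
    ReorderL L L' ∧ L'[k]? = some (i, r) ∧ L'[k+1]? = some (j, s) ∧
    uiApplicablePair r s ∧ P r s ∧
    ReorderL (uiAtL k L') M ∧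
    M.map Prod.fst =
      (L.map Prod.fst).filter fun x => decide (x ∈ (uiAtL k L').map Prod.fst)

/-- The relation `M = ui_{i,j}(L)`. -/
def UIrel (L : List LRow) (i j : ℕ) (M : List LRow) : Prop :=
  UIrelWith (fun _ _ => True) L i j M

/-- Atobe's dual of a labeled symbol. -/
def dualL (L : List LRow) : List LRow :=
  (L.mapIdx fun i p => (p.1, dualRow (rows L) i p.2)).reverse

/-- The partial dual `dual^+` at position `k` on a labeled symbol. -/
def dualPlusL (k : ℕ) (L : List LRow) : List LRow :=
  match L[k]? with
  | some (lab, rk) =>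
      (dualL ((dualL L).set (L.length - 1 - k)
          (lab, ⟨rk.A, 1 / 2, 0, - m1pow (gammaAt (rows L) k)⟩))).take k ++
        (lab, (⟨rk.A, -(1 / 2), 0, - rk.eta⟩ : Row)) :: L.drop (k + 1)
  | none => L

/-- Position of the row labeled `i`. -/
def posOf (L : List LRow) (i : ℕ) : ℕ := L.findIdx fun p => p.1 == i

/-- The partial dual `dual_i^+`, acting at the row labeled `i`. -/
def dualPlusLab (i : ℕ) (L : List LRow) : List LRow := dualPlusL (posOf L i) L

/-- Applicability of `dual_i^+` on a labeled symbol. -/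
def DualPlusApplicableLab (i : ℕ) (L : List LRow) : Prop :=
  i ∈ L.map Prod.fst ∧ DualPlusApplicable (rows L) (posOf L i)

/-- The partial dual `dual_i^-` on a labeled symbol. -/
def dualMinusLab (i : ℕ) (L : List LRow) : List LRow := dualL (dualPlusLab i (dualL L))

/-- Applicability of `dual_i^-` on a labeled symbol. -/
def DualMinusApplicableLab (i : ℕ) (L : List LRow) : Prop :=
  DualPlusApplicableLab i (dualL L)

/-- One basic operator step: a row exchange, a union-intersection, a composition
`dual ∘ ui_{i,j} ∘ dual`, or an inverse of one of these. -/
def BasicStep (L M : List LRow) : Prop :=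
  (∃ k, M = rexL k L) ∨ (∃ k, L = rexL k M) ∨
  (∃ i j, UIrel L i j M) ∨ (∃ i j, UIrel M i j L) ∨
  (∃ i j N, UIrel (dualL L) i j N ∧ M = dualL N) ∨
  (∃ i j N, UIrel (dualL M) i j N ∧ L = dualL N)

/-- Finite sequences of basic operators. -/
def Basic : List LRow → List LRow → Prop := Relation.ReflTransGen BasicStep

/-- Shift every row after position `j` one step to the right. -/
def shAfter (j : ℕ) (E : List Row) : List Row :=
  E.mapIdx fun i r => if j < i then r.sh 1 else r

/-- Shift every row with `B_i ≥ B` one step to the left. -/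
def shiftGE (B : ℚ) (E : List Row) : List Row :=
  E.map fun r => if B ≤ r.B then r.sh (-1) else r

/-- Shift every row with `B_i ≥ 1/2` one step to the left, deleting the rows of the
form `([1/2,1/2], 0, η)`. -/
def shiftHalfDel (E : List Row) : List Row :=
  (E.filter fun r => !decide (r.A = 1 / 2 ∧ r.B = 1 / 2 ∧ r.l = 0)).map
    fun r => if (1 / 2 : ℚ) ≤ r.B then r.sh (-1) else r

/-- The rows `([A-r, -(A-r)-1], ⌊A⌋-r, 1)` for `r = 0, …, ⌊A⌋`. -/
def prefixRows (A : ℚ) : List Row :=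
  (List.range (⌊A⌋.toNat + 1)).map fun r =>
    ⟨A - r, -(A - r) - 1, (⌊A⌋ : ℚ) - r, 1⟩

/-- A segment `[A,B]`. -/
structure Seg where
  A : ℚ
  B : ℚ
deriving DecidableEq

/-- Validity of a segment: `2A, 2B ∈ ℤ` and `A - B ∈ ℕ`. -/
def Seg.IsSeg (s : Seg) : Prop :=
  IsInt (2 * s.A) ∧ IsInt (2 * s.B) ∧ ∃ n : ℕ, s.A - s.B = (n : ℚ)

/-- The set `{B, B+1, …, A}` of a segment. -/
def Seg.points (s : Seg) : Set ℚ := {x | s.B ≤ x ∧ x ≤ s.A ∧ IsInt (x - s.B)}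

/-- Two segments have nonempty intersection. -/
def Seg.Meets (s t : Seg) : Prop := (s.points ∩ t.points).Nonempty

/-- A multiset of segments is connected: any two members are joined by a chain of
members of `S` in which consecutive members have nonempty intersection. -/
def SegConnected (S : Multiset Seg) : Prop :=
  ∀ a ∈ S, ∀ b ∈ S,
    Relation.ReflTransGen (fun x y => x ∈ S ∧ y ∈ S ∧ x.Meets y) a b

/-- A non-negative multiset of segments is of chain shape. -/
def ChainShape (S : Multiset Seg) : Prop :=
  (∀ s ∈ S, 0 ≤ s.B) ∧
  S.Pairwise (fun a b => (a.points ∩ b.points).Subsingleton) ∧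
  ∀ s ∈ S, ∀ C : ℚ, C < s.A → s.B < C → IsInt (s.A - C) →
    Even (S.count ⟨C, C⟩)

/-- `Cs` is a decomposition of `S` into connected components: the parts are nonempty,
connected and maximal among connected sub-multisets of `S`, and segments from
different parts have empty intersection. -/
def IsComponentDecomp (S : Multiset Seg) (Cs : Multiset (Multiset Seg)) : Prop :=
  Cs.sum = S ∧
  (∀ T ∈ Cs, T ≠ 0 ∧ SegConnected T ∧
    ∀ T', SegConnected T' → T ≤ T' → T' ≤ S → T' = T) ∧
  Cs.Pairwise (fun T U => ∀ a ∈ T, ∀ b ∈ U, ¬ a.Meets b)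

theorem Seg.Meets.symm {s t : Seg} (h : s.Meets t) : t.Meets s := by
  unfold Seg.Meets at *
  rwa [Set.inter_comm]

theorem Seg.IsSeg.meets_self {s : Seg} (h : s.IsSeg) : s.Meets s := by
  obtain ⟨-, -, n, hn⟩ := h
  have hle : s.B ≤ s.A := by
    have : (0 : ℚ) ≤ n := n.cast_nonneg
    linarith
  have hmem : s.B ∈ s.points := ⟨le_rfl, hle, by simp [IsInt]⟩
  exact ⟨s.B, hmem, hmem⟩

/-- A valid segment meets the singleton segment at any of its interior points. -/
theorem Seg.IsSeg.meets_singleton {s : Seg} (h : s.IsSeg) {C : ℚ} (hA : C < s.A)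
    (hB : s.B < C) (hC : IsInt (s.A - C)) : s.Meets ⟨C, C⟩ := by
  obtain ⟨-, -, n, hn⟩ := h
  have hCB : C - s.B = (((n : ℤ) - (s.A - C).num : ℤ) : ℚ) := by
    push_cast
    rw [Rat.coe_int_num_of_den_eq_one hC]
    linarith
  refine ⟨C, ⟨hB.le, hA.le, ?_⟩, le_rfl, le_rfl, by simp [IsInt]⟩
  rw [hCB]
  exact Rat.den_intCast _

/-- A multiset is pairwise related by a symmetric relation iff all its two-element
sub-multisets are. -/
theorem multiset_pairwise_iff_pair_le {α : Type*} {r : α → α → Prop}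
    (hr : ∀ a b, r a b → r b a) {S : Multiset α} :
    S.Pairwise r ↔ ∀ a b, ({a, b} : Multiset α) ≤ S → r a b := by
  have : Std.Symm r := ⟨hr⟩
  induction S using Quotient.inductionOn with
  | h l =>
    rw [Multiset.quot_mk_to_coe, Multiset.pairwise_coe_iff_pairwise,
      List.pairwise_iff_forall_sublist]
    refine ⟨fun h a b hab => ?_, fun h a b hab => h a b hab.subperm⟩
    obtain ⟨l', hp, hl'⟩ : [a, b].Subperm l := hab
    rcases List.perm_pair.1 hp with rfl | rfl
    · exact h hl'
    · exact hr _ _ (h hl')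

theorem multiset_pairwise_mono {α : Type*} {r : α → α → Prop} (hr : ∀ a b, r a b → r b a)
    {S T : Multiset α} (hTS : T ≤ S) (hS : S.Pairwise r) : T.Pairwise r := by
  rw [multiset_pairwise_iff_pair_le hr] at *
  exact fun a b hab => hS a b (hab.trans hTS)

/-- Consecutive members of a chain in `S`. -/
def Linked (S : Multiset Seg) (x y : Seg) : Prop := x ∈ S ∧ y ∈ S ∧ x.Meets y

/-- Two segments are joined by a chain in `S`. -/
def Joined (S : Multiset Seg) : Seg → Seg → Prop := Relation.ReflTransGen (Linked S)

theorem Joined.symm {S : Multiset Seg} {a b : Seg} (h : Joined S a b) : Joined S b a := by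
  induction h with
  | refl => exact .refl
  | tail _ h ih => exact .head ⟨h.2.1, h.1, h.2.2.symm⟩ ih

theorem Joined.mono {S T : Multiset Seg} (hTS : T ≤ S) {a b : Seg} (h : Joined T a b) :
    Joined S a b :=
  Relation.ReflTransGen.mono
    (fun _ _ h => ⟨Multiset.mem_of_le hTS h.1, Multiset.mem_of_le hTS h.2.1, h.2.2⟩) _ _ h

open Classical in
/-- The sub-multiset of members of `S` joined to `a`. -/
noncomputable def component (S : Multiset Seg) (a : Seg) : Multiset Seg :=
  S.filter (Joined S a)

open Classical in
theorem le_component_iff {S T : Multiset Seg} {a : Seg} :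
    T ≤ component S a ↔ T ≤ S ∧ ∀ b ∈ T, Joined S a b :=
  Multiset.le_filter

theorem component_le (S : Multiset Seg) (a : Seg) : component S a ≤ S :=
  (le_component_iff.1 le_rfl).1

theorem mem_component {S : Multiset Seg} {a b : Seg} :
    b ∈ component S a ↔ b ∈ S ∧ Joined S a b := by
  simp [component]

theorem self_mem_component {S : Multiset Seg} {a : Seg} (ha : a ∈ S) : a ∈ component S a :=
  mem_component.2 ⟨ha, .refl⟩

open Classical in
theorem component_eq_of_joined {S : Multiset Seg} {a b : Seg} (h : Joined S a b) :
    component S a = component S b :=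
  Multiset.filter_congr fun _ _ => ⟨h.symm.trans, h.trans⟩

theorem mem_component_of_meets {S : Multiset Seg} {a b c : Seg} (hb : b ∈ component S a)
    (hc : c ∈ S) (h : b.Meets c) : c ∈ component S a := by
  rw [mem_component] at *
  exact ⟨hc, hb.2.tail ⟨hb.1, hc, h⟩⟩

theorem le_component_of_connected {S T : Multiset Seg} (hT : SegConnected T) (hTS : T ≤ S)
    {a : Seg} (ha : a ∈ T) : T ≤ component S a :=
  le_component_iff.2 ⟨hTS, fun b hb => Joined.mono hTS (hT a ha b hb)⟩

theorem segConnected_component (S : Multiset Seg) (a : Seg) :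
    SegConnected (component S a) := by
  have key : ∀ b, Joined S a b → Joined (component S a) a b := by
    intro b h
    induction h with
    | refl => exact .refl
    | tail h₁ h₂ ih =>
      exact ih.tail ⟨mem_component.2 ⟨h₂.1, h₁⟩, mem_component.2 ⟨h₂.2.1, h₁.tail h₂⟩, h₂.2.2⟩
  intro b hb c hc
  exact (key b (mem_component.1 hb).2).symm.trans (key c (mem_component.1 hc).2)

open Classical in
theorem count_component {S : Multiset Seg} {a b : Seg} (h : b ∈ S → b ∈ component S a) :
    (component S a).count b = S.count b := by
  by_cases hb : b ∈ S
  · exact Multiset.count_filter_of_pos (mem_component.1 (h hb)).2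
  · rw [Multiset.count_eq_zero_of_notMem hb,
      Multiset.count_eq_zero_of_notMem fun h' => hb (mem_component.1 h').1]

open Classical in
/-- The set of connected components of `S`. -/
noncomputable def components (S : Multiset Seg) : Finset (Multiset Seg) :=
  S.toFinset.image (component S)

theorem mem_components {S T : Multiset Seg} :
    T ∈ components S ↔ ∃ a ∈ S, component S a = T := by
  simp [components]

theorem sum_components (S : Multiset Seg) : (components S).val.sum = S := by
  ext b
  have hsum : (components S).val.sum = ∑ T ∈ components S, T :=
    Finset.sum_val _
  rw [hsum, Multiset.count_sum']
  by_cases hb : b ∈ S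
  · rw [Finset.sum_eq_single_of_mem (component S b) (mem_components.2 ⟨b, hb, rfl⟩)]
    · exact count_component fun _ => self_mem_component hb
    · intro T hT hne
      obtain ⟨a, -, rfl⟩ := mem_components.1 hT
      exact Multiset.count_eq_zero_of_notMem fun h =>
        hne (component_eq_of_joined (mem_component.1 h).2)
  · rw [Multiset.count_eq_zero_of_notMem hb]
    refine Finset.sum_eq_zero fun T hT => Multiset.count_eq_zero_of_notMem fun h => hb ?_
    obtain ⟨a, -, rfl⟩ := mem_components.1 hT
    exact (mem_component.1 h).1

theorem isComponentDecomp_components (S : Multiset Seg) :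
    IsComponentDecomp S (components S).val := by
  refine ⟨sum_components S, fun T hT => ?_, Multiset.Nodup.pairwise ?_ (components S).nodup⟩
  · obtain ⟨a, ha, rfl⟩ := mem_components.1 hT
    have hmem := self_mem_component ha
    refine ⟨fun h => by simp [h] at hmem, segConnected_component S a, fun T' hT' hle hT'S => ?_⟩
    exact (le_component_of_connected hT' hT'S (Multiset.mem_of_le hle hmem)).antisymm hle
  · intro T hT U hU hne b hb c hc hbc
    obtain ⟨a, -, rfl⟩ := mem_components.1 hT
    obtain ⟨a', -, rfl⟩ := mem_components.1 hU
    have hc' := mem_component_of_meets hb (mem_component.1 hc).1 hbc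
    exact hne ((component_eq_of_joined (mem_component.1 hc').2).trans
      (component_eq_of_joined (mem_component.1 hc).2).symm)

theorem IsComponentDecomp.eq_components {S : Multiset Seg} (hS : ∀ s ∈ S, s.IsSeg)
    {Cs : Multiset (Multiset Seg)} (h : IsComponentDecomp S Cs) : Cs = (components S).val := by
  obtain ⟨hsum, hparts, hdisj⟩ := h
  have hle : ∀ T ∈ Cs, T ≤ S := fun T hT => hsum ▸ Multiset.le_sum_of_mem hT
  have heq : ∀ T ∈ Cs, ∀ a ∈ T, component S a = T := fun T hT a ha =>
    (hparts T hT).2.2 _ (segConnected_component S a)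
      (le_component_of_connected (hparts T hT).2.1 (hle T hT) ha) (component_le S a)
  have hnodup : Cs.Nodup := by
    rw [multiset_pairwise_iff_pair_le fun T U h a ha b hb hab => h b hb a ha hab.symm] at hdisj
    rw [Multiset.nodup_iff_le]
    intro T hT
    have hTC : T ∈ Cs := Multiset.mem_of_le hT (Multiset.mem_cons_self _ _)
    obtain ⟨a, ha⟩ := Multiset.exists_mem_of_ne_zero (hparts T hTC).1
    exact hdisj T T hT a ha a ha (hS a (Multiset.mem_of_le (hle T hTC) ha)).meets_self
  refine (Multiset.Nodup.ext hnodup (components S).nodup).2 fun T => ?_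
  rw [Finset.mem_val, mem_components]
  constructor
  · intro hT
    obtain ⟨a, ha⟩ := Multiset.exists_mem_of_ne_zero (hparts T hT).1
    exact ⟨a, Multiset.mem_of_le (hle T hT) ha, heq T hT a ha⟩
  · rintro ⟨a, ha, rfl⟩
    rw [← hsum] at ha
    obtain ⟨T, hT, haT⟩ := Multiset.mem_join.1 ha
    rwa [heq T hT a haT]

theorem points_inter_subsingleton_symm (a b : Seg) (h : (a.points ∩ b.points).Subsingleton) :
    (b.points ∩ a.points).Subsingleton := by
  rwa [Set.inter_comm]

/-- Singletons at interior points of a member of a component have the same multiplicity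
in the component as in the whole multiset. -/
theorem count_component_singleton {S : Multiset Seg} (hS : ∀ s ∈ S, s.IsSeg) {a s : Seg}
    (hs : s ∈ component S a) {C : ℚ} (hA : C < s.A) (hB : s.B < C) (hC : IsInt (s.A - C)) :
    (component S a).count ⟨C, C⟩ = S.count ⟨C, C⟩ :=
  count_component fun h =>
    mem_component_of_meets hs h ((hS s (mem_component.1 hs).1).meets_singleton hA hB hC)

theorem ChainShape.component {S : Multiset Seg} (hS : ∀ s ∈ S, s.IsSeg) (h : ChainShape S)
    (a : Seg) : ChainShape (component S a) := by
  obtain ⟨hnn, hpair, heven⟩ := h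
  refine ⟨fun s hs => hnn s (mem_component.1 hs).1,
    multiset_pairwise_mono points_inter_subsingleton_symm (component_le S a) hpair,
    fun s hs C hA hB hC => ?_⟩
  rw [count_component_singleton hS hs hA hB hC]
  exact heven s (mem_component.1 hs).1 C hA hB hC

theorem chainShape_of_component {S : Multiset Seg} (hS : ∀ s ∈ S, s.IsSeg)
    (h : ∀ a ∈ S, ChainShape (component S a)) : ChainShape S := by
  refine ⟨fun s hs => (h s hs).1 s (self_mem_component hs), ?_, fun s hs C hA hB hC => ?_⟩
  · rw [multiset_pairwise_iff_pair_le points_inter_subsingleton_symm]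
    intro a b hab
    have ha : a ∈ S := Multiset.mem_of_le hab (by simp)
    have hb : b ∈ S := Multiset.mem_of_le hab (by simp)
    by_cases hm : a.Meets b
    · refine (multiset_pairwise_iff_pair_le points_inter_subsingleton_symm).1 (h a ha).2.1 a b
        (le_component_iff.2 ⟨hab, fun c hc => ?_⟩)
      rcases Multiset.mem_cons.1 hc with rfl | hc
      · exact .refl
      · obtain rfl := Multiset.mem_singleton.1 hc
        exact .single ⟨ha, hb, hm⟩
    · rw [Seg.Meets, Set.not_nonempty_iff_eq_empty] at hm
      simp [hm]
  · rw [← count_component_singleton hS (self_mem_component hs) hA hB hC]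
    exact (h s hs).2.2 s (self_mem_component hs) C hA hB hC

/-- Lemma 8.11: (1) a finite multiset of segments decomposes uniquely into connected
components; (2) a non-negative multiset of segments is of chain shape if and only if
each of its connected components is. -/
theorem component_decomposition (S : Multiset Seg) (hS : ∀ s ∈ S, s.IsSeg) :
    (∃! Cs : Multiset (Multiset Seg), IsComponentDecomp S Cs) ∧
    ((∀ s ∈ S, 0 ≤ s.B) →
      ∀ Cs : Multiset (Multiset Seg), IsComponentDecomp S Cs →
        (ChainShape S ↔ ∀ T ∈ Cs, ChainShape T)) := by
  refine ⟨⟨_, isComponentDecomp_components S, fun Cs h => h.eq_components hS⟩, ?_⟩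
  intro _ Cs hCs
  rw [hCs.eq_components hS]
  constructor
  · intro h T hT
    obtain ⟨a, -, rfl⟩ := mem_components.1 hT
    exact h.component hS a
  · exact fun h => chainShape_of_component hS fun a ha => h _ (mem_components.2 ⟨a, ha, rfl⟩)

end LocalArthur
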